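/- Let Δf = A^{ab}∂_a∂_b f + A^a∂_a f + A·f be a second-order differential operator on smooth functions on ℝⁿ with smooth coefficients and A^{ab} = A^{ba}. Then there exist unique smooth functions S^{ab} = S^{ba}, X^a, F on ℝⁿ such that Δf = (1/2)(S^{ab}∂_a∂_b f + (∂_b S^{ba})∂_a f) + (X^a∂_a f + (1/2)(∂_a X^a)f) + F·f for all smooth f; namely S^{ab} = 2A^{ab}, X^a = A^a − ∂_b A^{ba}, F = A − (1/2)∂_a X^a. Moreover, for the pairing ∫_{ℝⁿ} f g dx on compactly supported smooth functions, the operator f ↦ (1/2)(S^{ab}∂_a∂_b f + (∂_b S^{ba})∂_a f) + F·f is symmetric and the operator L_X f = X^a∂_a f + (1/2)(∂_a X^a)f is antisymmetric (∫(L_X f)g dx = −∫ f(L_X g) dx). Consequently, ∫(Δf)·g dx = ∫ f·(Δg) dx for all compactly supported smooth f, g if and only if X^a ≡ 0, i.e. A^a = ∂_b A^{ba}. -/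

import Mathlib

open MeasureTheory Real

/-- Partial derivative of a function on ℝⁿ in the direction of the `a`-th coordinate. -/
noncomputable def pd {n : ℕ} (a : Fin n) (f : (Fin n → ℝ) → ℝ) : (Fin n → ℝ) → ℝ :=
  fun x => fderiv ℝ f x (Pi.single a 1)

section PartialDerivatives

variable {n : ℕ} {f g : (Fin n → ℝ) → ℝ}

lemma ContDiff.pd (hf : ContDiff ℝ (⊤ : ℕ∞) f) (a : Fin n) : ContDiff ℝ (⊤ : ℕ∞) (pd a f) :=
  (hf.fderiv_right (m := (⊤ : ℕ∞)) (by norm_cast)).clm_apply contDiff_const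

lemma ContDiff.differentiableAt_top (hf : ContDiff ℝ (⊤ : ℕ∞) f) (x : Fin n → ℝ) :
    DifferentiableAt ℝ f x :=
  hf.differentiable (by simp) x

lemma HasCompactSupport.pd (hf : HasCompactSupport f) (a : Fin n) :
    HasCompactSupport (pd a f) :=
  hf.fderiv_apply ℝ (Pi.single a 1)

lemma pd_mul (hf : ContDiff ℝ (⊤ : ℕ∞) f) (hg : ContDiff ℝ (⊤ : ℕ∞) g) (a : Fin n)
    (x : Fin n → ℝ) : pd a (fun y => f y * g y) x = pd a f x * g x + f x * pd a g x := by
  unfold _root_.pd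
  rw [fderiv_fun_mul (hf.differentiableAt_top x) (hg.differentiableAt_top x)]
  simp
  ring

lemma pd_sub (hf : ContDiff ℝ (⊤ : ℕ∞) f) (hg : ContDiff ℝ (⊤ : ℕ∞) g) (a : Fin n)
    (x : Fin n → ℝ) : pd a (fun y => f y - g y) x = pd a f x - pd a g x := by
  unfold _root_.pd
  rw [fderiv_fun_sub (hf.differentiableAt_top x) (hg.differentiableAt_top x)]
  simp

lemma pd_const (c : ℝ) (a : Fin n) (x : Fin n → ℝ) : pd a (fun _ => c) x = 0 := by
  simp [pd]

lemma pd_const_mul (hf : ContDiff ℝ (⊤ : ℕ∞) f) (c : ℝ) (a : Fin n) (x : Fin n → ℝ) :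
    pd a (fun y => c * f y) x = c * pd a f x := by
  rw [pd_mul contDiff_const hf, pd_const]
  ring

lemma pd_sum {ι : Type*} (s : Finset ι) {u : ι → (Fin n → ℝ) → ℝ}
    (hu : ∀ i, ContDiff ℝ (⊤ : ℕ∞) (u i)) (a : Fin n) (x : Fin n → ℝ) :
    pd a (fun y => ∑ i ∈ s, u i y) x = ∑ i ∈ s, pd a (u i) x := by
  unfold _root_.pd
  rw [fderiv_fun_sum fun i _ => (hu i).differentiableAt_top x]
  simp

lemma contDiff_coord_sub (i : Fin n) (c : ℝ) :
    ContDiff ℝ (⊤ : ℕ∞) (fun y : Fin n → ℝ => y i - c) := by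
  fun_prop

lemma pd_coord_sub (a i : Fin n) (c : ℝ) :
    pd a (fun y => y i - c) = fun _ => if a = i then 1 else 0 := by
  funext x
  have h : HasFDerivAt (fun y : Fin n → ℝ => y i - c)
      (ContinuousLinearMap.proj (R := ℝ) (φ := fun _ : Fin n => ℝ) i) x :=
    (hasFDerivAt_apply (𝕜 := ℝ) i x).sub_const c
  simp [pd, h.fderiv, Pi.single_apply, eq_comm]

lemma integral_pd_eq_zero (hf : ContDiff ℝ (⊤ : ℕ∞) f) (hfc : HasCompactSupport f)
    (a : Fin n) : ∫ x, pd a f x = 0 := by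
  have hint : Integrable (fun x => fderiv ℝ f x (Pi.single a 1)) :=
    (hf.pd a).continuous.integrable_of_hasCompactSupport (hfc.pd a)
  have h := integral_mul_fderiv_eq_neg_fderiv_mul_of_integrable (μ := volume)
    (f := fun _ : Fin n → ℝ => (1 : ℝ)) (g := f) (v := Pi.single a 1)
    (by simp) (by simpa only [one_mul] using hint)
    (by simpa using hf.continuous.integrable_of_hasCompactSupport hfc)
    (fun _ _ => differentiableAt_const _) (fun x _ => hf.differentiableAt_top x)
  simpa [pd] using h

/-- The divergence theorem for compactly supported fields, in the form used to compare
two integrals. -/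
lemma integral_eq_of_sub_eq_sum_pd {u v : (Fin n → ℝ) → ℝ} (hu : Integrable u)
    (hv : Integrable v) {W : Fin n → (Fin n → ℝ) → ℝ}
    (hW : ∀ a, ContDiff ℝ (⊤ : ℕ∞) (W a)) (hWc : ∀ a, HasCompactSupport (W a))
    (h : ∀ x, u x - v x = ∑ a, pd a (W a) x) : ∫ x, u x = ∫ x, v x := by
  rw [← sub_eq_zero, ← integral_sub hu hv]
  simp_rw [h]
  rw [integral_finsetSum _ fun a _ =>
    ((hW a).pd a).continuous.integrable_of_hasCompactSupport ((hWc a).pd a)]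
  exact Finset.sum_eq_zero fun a _ => integral_pd_eq_zero (hW a) (hWc a) a

/-- A second-order differential operator is determined by its action on functions. -/
lemma coeff_eq_zero_of_forall_contDiff {p : Fin n → Fin n → ℝ} (hp : ∀ a b, p a b = p b a)
    {r : Fin n → ℝ} {c : ℝ} {x : Fin n → ℝ}
    (h : ∀ f : (Fin n → ℝ) → ℝ, ContDiff ℝ (⊤ : ℕ∞) f →
      ∑ a, ∑ b, p a b * pd a (pd b f) x + ∑ a, r a * pd a f x + c * f x = 0) :
    (∀ a b, p a b = 0) ∧ (∀ a, r a = 0) ∧ c = 0 := by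
  have hpc : ∀ (k : ℝ) (b : Fin n), pd b (fun _ => k) = fun _ => (0 : ℝ) :=
    fun k b => funext fun y => pd_const k b y
  have hc : c = 0 := by simpa [hpc] using h (fun _ => 1) contDiff_const
  have hr : ∀ i, r i = 0 := fun i => by
    simpa [pd_coord_sub, hpc] using h _ (contDiff_coord_sub i (x i))
  refine ⟨fun i j => ?_, hr, hc⟩
  have hi := contDiff_coord_sub i (x i)
  have hj := contDiff_coord_sub j (x j)
  have h1 : ∀ b, pd b (fun y => (y i - x i) * (y j - x j)) =
      fun y => (y j - x j) * (if b = i then 1 else 0) - (if b = j then -1 else 0) * (y i - x i) := by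
    intro b
    funext y
    rw [pd_mul hi hj, pd_coord_sub, pd_coord_sub]
    split_ifs <;> ring
  have h2 : ∀ a b, pd a (pd b (fun y => (y i - x i) * (y j - x j))) x =
      (if a = j then 1 else 0) * (if b = i then 1 else 0) +
      (if b = j then 1 else 0) * (if a = i then 1 else 0) := by
    intro a b
    rw [h1, pd_sub (hj.mul contDiff_const) (contDiff_const.mul hi), pd_mul hj contDiff_const,
      pd_const_mul hi, pd_const, pd_coord_sub, pd_coord_sub]
    split_ifs <;> ring
  have h3 := h _ (hi.mul hj)
  simp only [h2, hr, hc] at h3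
  simp [mul_add, Finset.sum_add_distrib] at h3
  linarith [hp i j]

end PartialDerivatives

section Operators

variable {n : ℕ}

/-- The operator `f ↦ ½ (S^{ab} ∂_a ∂_b f + (∂_b S^{ba}) ∂_a f) + F f`. -/
noncomputable def singularOperator (S : Fin n → Fin n → (Fin n → ℝ) → ℝ) (F : (Fin n → ℝ) → ℝ)
    (f : (Fin n → ℝ) → ℝ) (x : Fin n → ℝ) : ℝ :=
  (1/2) * (∑ a, ∑ b, S a b x * pd a (pd b f) x + ∑ a, (∑ b, pd b (S b a) x) * pd a f x)
    + F x * f x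

/-- The generalized Lie derivative `f ↦ X^a ∂_a f + ½ (∂_a X^a) f` on half-densities. -/
noncomputable def lieDerivative (X : Fin n → (Fin n → ℝ) → ℝ)
    (f : (Fin n → ℝ) → ℝ) (x : Fin n → ℝ) : ℝ :=
  ∑ a, X a x * pd a f x + (1/2) * (∑ a, pd a (X a) x) * f x

variable {S : Fin n → Fin n → (Fin n → ℝ) → ℝ} {X : Fin n → (Fin n → ℝ) → ℝ}
  {F f g : (Fin n → ℝ) → ℝ}

lemma ContDiff.singularOperator (hS : ∀ a b, ContDiff ℝ (⊤ : ℕ∞) (S a b))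
    (hF : ContDiff ℝ (⊤ : ℕ∞) F) (hf : ContDiff ℝ (⊤ : ℕ∞) f) :
    ContDiff ℝ (⊤ : ℕ∞) (singularOperator S F f) :=
  (contDiff_const.mul ((ContDiff.sum fun a _ => ContDiff.sum fun b _ =>
    (hS a b).mul ((hf.pd b).pd a)).add (ContDiff.sum fun a _ =>
      (ContDiff.sum fun b _ => (hS b a).pd b).mul (hf.pd a)))).add (hF.mul hf)

lemma ContDiff.lieDerivative (hX : ∀ a, ContDiff ℝ (⊤ : ℕ∞) (X a))
    (hf : ContDiff ℝ (⊤ : ℕ∞) f) : ContDiff ℝ (⊤ : ℕ∞) (lieDerivative X f) :=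
  (ContDiff.sum fun a _ => (hX a).mul (hf.pd a)).add
    ((contDiff_const.mul (ContDiff.sum fun a _ => (hX a).pd a)).mul hf)

lemma integral_singularOperator_mul (hS : ∀ a b, ContDiff ℝ (⊤ : ℕ∞) (S a b))
    (hSs : ∀ a b, S a b = S b a) (hF : ContDiff ℝ (⊤ : ℕ∞) F)
    (hf : ContDiff ℝ (⊤ : ℕ∞) f) (hfc : HasCompactSupport f)
    (hg : ContDiff ℝ (⊤ : ℕ∞) g) (hgc : HasCompactSupport g) :
    ∫ x, singularOperator S F f x * g x = ∫ x, f x * singularOperator S F g x := by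
  have hD : ∀ b, ContDiff ℝ (⊤ : ℕ∞) (fun y => pd b f y * g y - f y * pd b g y) :=
    fun b => ((hf.pd b).mul hg).sub (hf.mul (hg.pd b))
  have hSD : ∀ a b, ContDiff ℝ (⊤ : ℕ∞)
      (fun y => S a b y * (pd b f y * g y - f y * pd b g y)) := fun a b => (hS a b).mul (hD b)
  refine integral_eq_of_sub_eq_sum_pd
    (W := fun a y => (1/2) * ∑ b, S a b y * (pd b f y * g y - f y * pd b g y))
    (((ContDiff.singularOperator hS hF hf).mul hg).continuous.integrable_of_hasCompactSupport
      hgc.mul_left)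
    ((hf.mul (ContDiff.singularOperator hS hF hg)).continuous.integrable_of_hasCompactSupport
      hfc.mul_right)
    (fun a => contDiff_const.mul (ContDiff.sum fun b _ => hSD a b))
    (fun a => hfc.mono' fun y hy => ?_) fun x => ?_
  · by_contra hyf
    have h0 : f y = 0 := image_eq_zero_of_notMem_tsupport hyf
    have h1 : ∀ b, pd b f y = 0 := fun b => by
      simp [pd, fderiv_of_notMem_tsupport ℝ hyf]
    exact hy (by simp [h0, h1])
  · have hW : ∀ a, pd a (fun y => (1/2) * ∑ b, S a b y * (pd b f y * g y - f y * pd b g y)) x =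
        (1/2) * ∑ b, (pd a (S a b) x * pd b f x * g x - f x * (pd a (S a b) x * pd b g x)
          + (S a b x * pd a (pd b f) x * g x - f x * (S a b x * pd a (pd b g) x))
          + (S a b x * (pd b f x * pd a g x) - S a b x * (pd a f x * pd b g x))) := by
      intro a
      rw [pd_const_mul (ContDiff.sum fun b _ => hSD a b), pd_sum _ (hSD a)]
      congr 1
      refine Finset.sum_congr rfl fun b _ => ?_
      rw [pd_mul (hS a b) (hD b), pd_sub ((hf.pd b).mul hg) (hf.mul (hg.pd b)),
        pd_mul (hf.pd b) hg, pd_mul hf (hg.pd b)]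
      ring
    have hcross : ∑ a, ∑ b, S a b x * (pd b f x * pd a g x) =
        ∑ a, ∑ b, S a b x * (pd a f x * pd b g x) := by
      rw [Finset.sum_comm]
      exact Finset.sum_congr rfl fun a _ => Finset.sum_congr rfl fun b _ => by rw [hSs b a]
    have hfirst : ∀ u : (Fin n → ℝ) → ℝ, ∑ a, (∑ b, pd b (S b a) x) * pd a u x =
        ∑ a, ∑ b, pd a (S a b) x * pd b u x := fun u => by
      rw [Finset.sum_comm]
      simp only [Finset.sum_mul]
    simp only [hW, ← Finset.mul_sum, Finset.sum_add_distrib, Finset.sum_sub_distrib, hcross,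
      ← Finset.sum_mul, singularOperator, hfirst]
    ring

lemma integral_lieDerivative_mul (hX : ∀ a, ContDiff ℝ (⊤ : ℕ∞) (X a))
    (hf : ContDiff ℝ (⊤ : ℕ∞) f) (hfc : HasCompactSupport f)
    (hg : ContDiff ℝ (⊤ : ℕ∞) g) (hgc : HasCompactSupport g) :
    ∫ x, lieDerivative X f x * g x = - ∫ x, f x * lieDerivative X g x := by
  rw [← integral_neg]
  refine integral_eq_of_sub_eq_sum_pd (W := fun a y => X a y * (f y * g y))
    (((ContDiff.lieDerivative hX hf).mul hg).continuous.integrable_of_hasCompactSupport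
      hgc.mul_left)
    ((hf.mul (ContDiff.lieDerivative hX hg)).continuous.integrable_of_hasCompactSupport
      hfc.mul_right).neg
    (fun a => (hX a).mul (hf.mul hg)) (fun a => hgc.mul_left.mul_left) fun x => ?_
  have hW : ∀ a, pd a (fun y => X a y * (f y * g y)) x =
      pd a (X a) x * (f x * g x) + (X a x * pd a f x * g x + f x * (X a x * pd a g x)) := by
    intro a
    rw [pd_mul (hX a) (hf.mul hg), pd_mul hf hg]
    ring
  simp only [hW, Finset.sum_add_distrib, ← Finset.sum_mul, ← Finset.mul_sum, lieDerivative]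
  ring

/-- A vector field whose generalized Lie derivative pairs to zero with all test functions
vanishes. -/
lemma eq_zero_of_integral_lieDerivative_mul_eq_zero (hX : ∀ a, ContDiff ℝ (⊤ : ℕ∞) (X a))
    (h : ∀ f g : (Fin n → ℝ) → ℝ, ContDiff ℝ (⊤ : ℕ∞) f → HasCompactSupport f →
      ContDiff ℝ (⊤ : ℕ∞) g → HasCompactSupport g → ∫ x, lieDerivative X f x * g x = 0)
    (a : Fin n) (x : Fin n → ℝ) : X a x = 0 := by
  obtain ⟨χ, -, hχc, hχ, -, hχx⟩ := exists_contDiff_tsupport_subset (n := (⊤ : ℕ∞))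
    (Filter.univ_mem (f := nhds x))
  have hcoord := contDiff_coord_sub a (x a)
  have hf := hχ.mul hcoord
  have hLc := (ContDiff.lieDerivative hX hf).continuous
  have hae := ae_eq_zero_of_integral_contDiff_smul_eq_zero
    (μ := (volume : Measure (Fin n → ℝ))) hLc.locallyIntegrable
    fun g hg hgc => by simpa [mul_comm] using h _ g hf hχc.mul_right hg hgc
  have h0 := congrFun (hLc.ae_eq_iff_eq volume continuous_const |>.mp hae) x
  simpa [lieDerivative, pd_mul hχ hcoord, pd_coord_sub, hχx] using h0

end Operators

/-- the canonical decomposition `Δ = Δ_sing + L_X + F` of a second order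
operator into a symmetric second-order part, an antisymmetric generalized Lie derivative,
and a multiplication operator; and the characterization of symmetry of `Δ`. -/
theorem statement7 (n : ℕ)
    (A2 : Fin n → Fin n → (Fin n → ℝ) → ℝ) (A1 : Fin n → (Fin n → ℝ) → ℝ)
    (A0 : (Fin n → ℝ) → ℝ)
    (hA2 : ∀ a b, ContDiff ℝ (⊤ : ℕ∞) (A2 a b)) (hA2symm : ∀ a b, A2 a b = A2 b a)
    (hA1 : ∀ a, ContDiff ℝ (⊤ : ℕ∞) (A1 a)) (hA0 : ContDiff ℝ (⊤ : ℕ∞) A0)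
    -- the explicit data S, X, F:
    (S : Fin n → Fin n → (Fin n → ℝ) → ℝ) (X : Fin n → (Fin n → ℝ) → ℝ)
    (F : (Fin n → ℝ) → ℝ)
    (hS : ∀ a b x, S a b x = 2 * A2 a b x)
    (hX : ∀ a x, X a x = A1 a x - ∑ b, pd b (A2 b a) x)
    (hF : ∀ x, F x = A0 x - (1/2) * ∑ a, pd a (X a) x) :
    -- existence of the decomposition with the explicit S, X, F:
    ((∀ a b, ContDiff ℝ (⊤ : ℕ∞) (S a b)) ∧ (∀ a b, S a b = S b a) ∧
     (∀ a, ContDiff ℝ (⊤ : ℕ∞) (X a)) ∧ ContDiff ℝ (⊤ : ℕ∞) F ∧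
     (∀ f : (Fin n → ℝ) → ℝ, ContDiff ℝ (⊤ : ℕ∞) f → ∀ x,
        ∑ a, ∑ b, A2 a b x * pd a (pd b f) x + ∑ a, A1 a x * pd a f x + A0 x * f x
        = (1/2) * (∑ a, ∑ b, S a b x * pd a (pd b f) x + ∑ a, (∑ b, pd b (S b a) x) * pd a f x)
          + (∑ a, X a x * pd a f x + (1/2) * (∑ a, pd a (X a) x) * f x)
          + F x * f x))
    ∧
    -- uniqueness of such a decomposition:
    (∀ (S' : Fin n → Fin n → (Fin n → ℝ) → ℝ) (X' : Fin n → (Fin n → ℝ) → ℝ)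
       (F' : (Fin n → ℝ) → ℝ),
      (∀ a b, ContDiff ℝ (⊤ : ℕ∞) (S' a b)) → (∀ a b, S' a b = S' b a) →
      (∀ a, ContDiff ℝ (⊤ : ℕ∞) (X' a)) → ContDiff ℝ (⊤ : ℕ∞) F' →
      (∀ f : (Fin n → ℝ) → ℝ, ContDiff ℝ (⊤ : ℕ∞) f → ∀ x,
        ∑ a, ∑ b, A2 a b x * pd a (pd b f) x + ∑ a, A1 a x * pd a f x + A0 x * f x
        = (1/2) * (∑ a, ∑ b, S' a b x * pd a (pd b f) x + ∑ a, (∑ b, pd b (S' b a) x) * pd a f x)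
          + (∑ a, X' a x * pd a f x + (1/2) * (∑ a, pd a (X' a) x) * f x)
          + F' x * f x) →
      (∀ a b, S' a b = S a b) ∧ (∀ a, X' a = X a) ∧ F' = F)
    ∧
    -- the second-order part plus F is symmetric for the pairing ∫ f g dx:
    (∀ f g : (Fin n → ℝ) → ℝ, ContDiff ℝ (⊤ : ℕ∞) f → HasCompactSupport f →
      ContDiff ℝ (⊤ : ℕ∞) g → HasCompactSupport g →
      ∫ x, ((1/2) * (∑ a, ∑ b, S a b x * pd a (pd b f) x
              + ∑ a, (∑ b, pd b (S b a) x) * pd a f x) + F x * f x) * g x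
      = ∫ x, f x * ((1/2) * (∑ a, ∑ b, S a b x * pd a (pd b g) x
              + ∑ a, (∑ b, pd b (S b a) x) * pd a g x) + F x * g x))
    ∧
    -- the generalized Lie derivative L_X is antisymmetric:
    (∀ f g : (Fin n → ℝ) → ℝ, ContDiff ℝ (⊤ : ℕ∞) f → HasCompactSupport f →
      ContDiff ℝ (⊤ : ℕ∞) g → HasCompactSupport g →
      ∫ x, (∑ a, X a x * pd a f x + (1/2) * (∑ a, pd a (X a) x) * f x) * g x
      = - ∫ x, f x * (∑ a, X a x * pd a g x + (1/2) * (∑ a, pd a (X a) x) * g x))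
    ∧
    -- consequently Δ is symmetric iff X ≡ 0, i.e. A^a = ∂_b A^{ba}:
    ((∀ f g : (Fin n → ℝ) → ℝ, ContDiff ℝ (⊤ : ℕ∞) f → HasCompactSupport f →
       ContDiff ℝ (⊤ : ℕ∞) g → HasCompactSupport g →
       ∫ x, (∑ a, ∑ b, A2 a b x * pd a (pd b f) x + ∑ a, A1 a x * pd a f x + A0 x * f x) * g x
       = ∫ x, f x * (∑ a, ∑ b, A2 a b x * pd a (pd b g) x + ∑ a, A1 a x * pd a g x + A0 x * g x))
      ↔ (∀ a x, X a x = 0)) := by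
  have hSfun : ∀ a b, S a b = fun x => 2 * A2 a b x := fun a b => funext (hS a b)
  have hSs : ∀ a b, S a b = S b a := fun a b => by rw [hSfun, hSfun, hA2symm]
  have hSc : ∀ a b, ContDiff ℝ (⊤ : ℕ∞) (S a b) := fun a b => by
    rw [hSfun]
    exact contDiff_const.mul (hA2 a b)
  have hXc : ∀ a, ContDiff ℝ (⊤ : ℕ∞) (X a) := fun a => by
    rw [funext (hX a)]
    exact (hA1 a).sub (ContDiff.sum fun b _ => (hA2 b a).pd b)
  have hFc : ContDiff ℝ (⊤ : ℕ∞) F := by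
    rw [funext hF]
    exact hA0.sub (contDiff_const.mul (ContDiff.sum fun a _ => (hXc a).pd a))
  have hpdS : ∀ a b x, pd b (S b a) x = 2 * pd b (A2 b a) x := fun a b x => by
    rw [hSfun, pd_const_mul (hA2 b a)]
  have hdec : ∀ (f : (Fin n → ℝ) → ℝ) (x : Fin n → ℝ),
      ∑ a, ∑ b, A2 a b x * pd a (pd b f) x + ∑ a, A1 a x * pd a f x + A0 x * f x
        = singularOperator S F f x + lieDerivative X f x := by
    intro f x
    simp only [singularOperator, lieDerivative, hF, hS, hpdS, hX, sub_mul,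
      Finset.sum_sub_distrib, mul_assoc, ← Finset.mul_sum]
    ring
  refine ⟨⟨hSc, hSs, hXc, hFc, fun f _ x => ?_⟩, ?_, ?_, ?_, ?_⟩
  · rw [hdec, singularOperator, lieDerivative]
    ring
  · intro S' X' F' hS'c hS's hX'c hF'c h
    have key := fun x => coeff_eq_zero_of_forall_contDiff (x := x)
      (p := fun a b => A2 a b x - 1/2 * S' a b x)
      (r := fun a => A1 a x - 1/2 * (∑ b, pd b (S' b a) x) - X' a x)
      (c := A0 x - 1/2 * (∑ a, pd a (X' a) x) - F' x)
      (fun a b => by rw [hA2symm a b, hS's a b])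
      (fun f hf => by
        have := h f hf x
        simp only [sub_mul, Finset.sum_sub_distrib, mul_assoc, ← Finset.mul_sum] at this ⊢
        linarith)
    have hSS : ∀ a b, S' a b = S a b := fun a b => funext fun x => by
      linarith [(key x).1 a b, hS a b x]
    have hXX : ∀ a, X' a = X a := fun a => funext fun x => by
      have := (key x).2.1 a
      simp only [hSS, hpdS, ← Finset.mul_sum] at this
      linarith [hX a x]
    refine ⟨hSS, hXX, funext fun x => ?_⟩
    have := (key x).2.2
    simp only [hXX] at this
    linarith [hF x]
  · intro f g hf hfc hg hgc
    exact integral_singularOperator_mul hSc hSs hFc hf hfc hg hgc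
  · intro f g hf hfc hg hgc
    exact integral_lieDerivative_mul hXc hf hfc hg hgc
  · simp only [hdec, add_mul, mul_add]
    have hsplit : ∀ f g : (Fin n → ℝ) → ℝ, ContDiff ℝ (⊤ : ℕ∞) f → HasCompactSupport f →
        ContDiff ℝ (⊤ : ℕ∞) g → HasCompactSupport g →
        (∫ x, (singularOperator S F f x * g x + lieDerivative X f x * g x)
          = ∫ x, (f x * singularOperator S F g x + f x * lieDerivative X g x)
        ↔ ∫ x, lieDerivative X f x * g x = 0) := by
      intro f g hf hfc hg hgc
      have hint : ∀ {u v : (Fin n → ℝ) → ℝ}, ContDiff ℝ (⊤ : ℕ∞) u → ContDiff ℝ (⊤ : ℕ∞) v →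
          HasCompactSupport v → Integrable (fun x => u x * v x) := fun hu hv hvc =>
        (hu.mul hv).continuous.integrable_of_hasCompactSupport hvc.mul_left
      rw [integral_add (hint (ContDiff.singularOperator hSc hFc hf) hg hgc)
          (hint (ContDiff.lieDerivative hXc hf) hg hgc),
        integral_add
          (by simpa only [mul_comm] using hint (ContDiff.singularOperator hSc hFc hg) hf hfc)
          (by simpa only [mul_comm] using hint (ContDiff.lieDerivative hXc hg) hf hfc),
        integral_singularOperator_mul hSc hSs hFc hf hfc hg hgc]
      have := integral_lieDerivative_mul hXc hf hfc hg hgc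
      constructor <;> intro _ <;> linarith
    constructor
    · intro h
      exact eq_zero_of_integral_lieDerivative_mul_eq_zero hXc fun f g hf hfc hg hgc =>
        (hsplit f g hf hfc hg hgc).mp (h f g hf hfc hg hgc)
    · intro h f g hf hfc hg hgc
      have hX0 : X = fun _ _ => 0 := funext fun a => funext (h a)
      rw [hsplit f g hf hfc hg hgc]
      simp [lieDerivative, hX0, pd_const]
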